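/- For every c >= 1, k >= 1, every n >= 3c^2 + 6c + 3, and every number of players p >= c + 2, no player has a winning strategy in the p-player (c,k)-nacci Zeckendorf game on n. -/

import Mathlib

/-- The `(c,k)`-nacci numbers: `nacci c k 1 = 1`,
`nacci c k (i+1) = c * (nacci c k i + ⋯ + nacci c k 1) + 1` for `1 ≤ i ≤ k`, and
`nacci c k (i+1) = c * (nacci c k i + ⋯ + nacci c k (i-k))` for `i ≥ k + 1`.
(The value at `0` is junk.) -/
def nacci (c k : ℕ) : ℕ → ℕ
  | 0 => 0
  | 1 => 1
  | (i + 2) =>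
    if i + 1 ≤ k then
      c * ((Finset.range (i + 1)).attach.sum fun j => nacci c k (j.1 + 1)) + 1
    else
      c * ((Finset.Icc (i + 1 - k) (i + 1)).attach.sum fun j => nacci c k j.1)
decreasing_by
  · have hj := j.2
    simp only [Finset.mem_range] at hj
    omega
  · have hj := j.2
    simp only [Finset.mem_Icc] at hj
    omega


/-- The multiset consisting of `c` copies of `nacci c k j` for each `j` in the
finite set `s`. -/
def nacciBlock (c k : ℕ) (s : Finset ℕ) : Multiset ℕ :=
  s.val.bind fun j => Multiset.replicate c (nacci c k j)

/-- A legal move of the `(c,k)`-nacci Zeckendorf game, as a relation between the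
position before and the position after the move (positions are multisets of naturals). -/
def CkMove (c k : ℕ) (A B : Multiset ℕ) : Prop :=
  -- (1) for `i ≥ k+1`: `c` copies each of `S_{i-k}, …, S_i` become `S_{i+1}`
  (∃ i, k + 1 ≤ i ∧ nacciBlock c k (Finset.Icc (i - k) i) ≤ A ∧
    B = A - nacciBlock c k (Finset.Icc (i - k) i) + {nacci c k (i + 1)}) ∨
  -- (2) for `2 ≤ i ≤ k`: `c+1` copies of `S_1` and `c` copies each of `S_2, …, S_i`
  -- become `S_{i+1}`
  (∃ i, 2 ≤ i ∧ i ≤ k ∧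
    Multiset.replicate (c + 1) (nacci c k 1) + nacciBlock c k (Finset.Icc 2 i) ≤ A ∧
    B = A - (Multiset.replicate (c + 1) (nacci c k 1) + nacciBlock c k (Finset.Icc 2 i))
        + {nacci c k (i + 1)}) ∨
  -- (3) `c+1` copies of `S_1` become `S_2`
  (Multiset.replicate (c + 1) (nacci c k 1) ≤ A ∧
    B = A - Multiset.replicate (c + 1) (nacci c k 1) + {nacci c k 2}) ∨
  -- (3) for `1 < i < k+1`: `c+1` copies of `S_i` become `S_{i+1}`
  (∃ i, 1 < i ∧ i < k + 1 ∧ Multiset.replicate (c + 1) (nacci c k i) ≤ A ∧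
    B = A - Multiset.replicate (c + 1) (nacci c k i) + {nacci c k (i + 1)}) ∨
  -- (3) `c+1` copies of `S_{k+1}` become `S_{k+2}` and `S_1`
  (Multiset.replicate (c + 1) (nacci c k (k + 1)) ≤ A ∧
    B = A - Multiset.replicate (c + 1) (nacci c k (k + 1))
        + {nacci c k (k + 2), nacci c k 1}) ∨
  -- (3) for `i > k+1`: `c+1` copies of `S_i` become `S_{i+1}` and `c` copies of `S_{i-k-1}`
  (∃ i, k + 1 < i ∧ Multiset.replicate (c + 1) (nacci c k i) ≤ A ∧
    B = A - Multiset.replicate (c + 1) (nacci c k i)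
        + ({nacci c k (i + 1)} + Multiset.replicate c (nacci c k (i - k - 1))))

/-- A position is terminal when no legal move remains. -/
def Terminal (Move : Multiset ℕ → Multiset ℕ → Prop) (pos : Multiset ℕ) : Prop :=
  ∀ B, ¬ Move pos B

/-- `AllianceWins Move p team t pos`: in the `p`-player game with move relation `Move`,
where players `1, …, p` move cyclically (the mover of the `t`-th move, counting from `t = 0`,
is player `t % p + 1`) and the side making the last legal move wins, the alliance
(set of players) `team` can guarantee, from position `pos` with `t` moves already made,
that one of its members makes the last move, no matter how the other players play. -/
inductive AllianceWins (Move : Multiset ℕ → Multiset ℕ → Prop) (p : ℕ) (team : ℕ → Prop) :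
    ℕ → Multiset ℕ → Prop
  | endMove (t : ℕ) (pos B : Multiset ℕ) (hturn : team (t % p + 1)) (hmove : Move pos B)
      (hterm : Terminal Move B) : AllianceWins Move p team t pos
  | contMove (t : ℕ) (pos B : Multiset ℕ) (hturn : team (t % p + 1)) (hmove : Move pos B)
      (hwin : AllianceWins Move p team (t + 1) B) : AllianceWins Move p team t pos
  | oppMove (t : ℕ) (pos : Multiset ℕ) (hturn : ¬ team (t % p + 1))
      (hex : ∃ B, Move pos B)
      (hall : ∀ B, Move pos B → AllianceWins Move p team (t + 1) B) :
      AllianceWins Move p team t pos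

/-- Player `m` has a winning strategy in the `p`-player game on `n`
(played from `n` copies of `1`, with player 1 moving first). -/
def PlayerWins (Move : Multiset ℕ → Multiset ℕ → Prop) (p m n : ℕ) : Prop :=
  AllianceWins Move p (fun q => q = m) 0 (Multiset.replicate n 1)


lemma nacci_one' (c k : ℕ) : nacci c k 1 = 1 := by
  rw [nacci]

lemma nacci_pos_lt (c k : ℕ) (hc : 1 ≤ c) (hk : 1 ≤ k) :
    ∀ i, 1 ≤ i → 0 < nacci c k i ∧ nacci c k i < nacci c k (i + 1) := by
  intro i
  induction i using Nat.strong_induction_on with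
  | _ i ih =>
    intro hi
    have hpos : 0 < nacci c k i := by
      rcases Nat.lt_or_ge 1 i with h | h
      · have := (ih (i - 1) (by omega) (by omega)).2
        rw [Nat.sub_add_cancel hi] at this
        omega
      · have : i = 1 := by omega
        subst this
        rw [nacci_one']; norm_num
    refine ⟨hpos, ?_⟩
    obtain ⟨l, rfl⟩ : ∃ l, i = l + 1 := ⟨i - 1, by omega⟩
    rw [show l + 1 + 1 = l + 2 from rfl, nacci.eq_3 c k l]
    split_ifs with h
    · rw [Finset.sum_attach (Finset.range (l + 1)) (fun j => nacci c k (j + 1))]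
      have h1 : nacci c k (l + 1) ≤ ∑ j ∈ Finset.range (l + 1), nacci c k (j + 1) :=
        Finset.single_le_sum (f := fun j => nacci c k (j + 1)) (fun _ _ => Nat.zero_le _)
          (Finset.self_mem_range_succ l)
      nlinarith
    · rw [Finset.sum_attach (Finset.Icc (l + 1 - k) (l + 1)) (fun j => nacci c k j)]
      have hl := (ih l (by omega) (by omega)).1
      have h1 : ∑ j ∈ ({l, l + 1} : Finset ℕ), nacci c k j
          ≤ ∑ j ∈ Finset.Icc (l + 1 - k) (l + 1), nacci c k j := by
        apply Finset.sum_le_sum_of_subset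
        intro x hx
        simp only [Finset.mem_insert, Finset.mem_singleton] at hx
        rw [Finset.mem_Icc]; omega
      rw [Finset.sum_pair (by omega)] at h1
      nlinarith

lemma nacci_inj (c k : ℕ) (hc : 1 ≤ c) (hk : 1 ≤ k) (i j : ℕ) (hi : 1 ≤ i) (hj : 1 ≤ j) :
    nacci c k i = nacci c k j ↔ i = j := by
  have hm : StrictMono (fun i => nacci c k (i + 1)) :=
    strictMono_nat_of_lt_succ (fun n => (nacci_pos_lt c k hc hk (n + 1) (by omega)).2)
  constructor
  · intro h
    have := hm.injective (a₁ := i - 1) (a₂ := j - 1) (by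
      simp only [Nat.sub_add_cancel hi, Nat.sub_add_cancel hj]; exact h)
    omega
  · rintro rfl; rfl

/-- Positions with `a` copies of `S_1`, `b` copies of `S_2`, and the rest `Q`. -/
def Pos (c k a b : ℕ) (Q : Multiset ℕ) : Multiset ℕ :=
  Multiset.replicate a (nacci c k 1) + Multiset.replicate b (nacci c k 2) + Q

/-- The number of ones left over. -/
def ee (k : ℕ) : ℕ := if k = 1 then 1 else 0

lemma block_le (c k : ℕ) (s : Finset ℕ) (j : ℕ) (hj : j ∈ s) :
    Multiset.replicate c (nacci c k j) ≤ nacciBlock c k s :=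
  Multiset.le_bind (f := fun j => Multiset.replicate c (nacci c k j)) s.val hj

lemma block_insert (c k : ℕ) (s : Finset ℕ) (j : ℕ) (hj : j ∉ s) :
    nacciBlock c k (insert j s) = Multiset.replicate c (nacci c k j) + nacciBlock c k s := by
  unfold nacciBlock
  rw [Finset.insert_val_of_notMem hj, Multiset.cons_bind]

lemma block_single (c k : ℕ) (j : ℕ) :
    nacciBlock c k {j} = Multiset.replicate c (nacci c k j) := by
  unfold nacciBlock
  simp

lemma sub_form {A X R Y B : Multiset ℕ} (h : A = X + R) (hB : B = R + Y) :
    X ≤ A ∧ B = A - X + Y := by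
  subst h hB
  exact ⟨Multiset.le_add_right _ _, by rw [add_tsub_cancel_left]⟩

lemma sub_form' {A X R Y B : Multiset ℕ} (h : A = X + R) (hB : B = A - X + Y) :
    B = R + Y := by
  subst h hB
  rw [add_tsub_cancel_left]

lemma move_merge (c k a b : ℕ) (Q : Multiset ℕ) :
    CkMove c k (Pos c k (a + (c + 1)) b Q) (Pos c k a (b + 1) Q) := by
  right; right; left
  apply sub_form (R := Pos c k a b Q)
  · unfold Pos; rw [Multiset.replicate_add]; abel
  · unfold Pos; rw [Multiset.replicate_add, Multiset.replicate_one]; abel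

lemma move_merge2 (c k a b : ℕ) (Q : Multiset ℕ) (hk : 1 ≤ k) :
    CkMove c k (Pos c k a (b + (c + 1)) Q) (Pos c k (a + ee k) b (Q + {nacci c k 3})) := by
  by_cases h : k = 1
  · subst h
    right; right; right; right; left
    apply sub_form (R := Pos c 1 a b Q)
    · unfold Pos; rw [Multiset.replicate_add b]; abel
    · unfold Pos ee
      rw [if_pos rfl, Multiset.replicate_add a 1, Multiset.replicate_one,
        Multiset.insert_eq_cons, ← Multiset.singleton_add]
      abel
  · right; right; right; left
    refine ⟨2, by omega, by omega, ?_⟩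
    apply sub_form (R := Pos c k a b Q)
    · unfold Pos; rw [Multiset.replicate_add b]; abel
    · unfold Pos ee
      rw [if_neg h, add_zero]
      abel

lemma move_comb (c k a b : ℕ) (Q : Multiset ℕ) (hk : 1 ≤ k) :
    CkMove c k (Pos c k (a + (c + 1)) (b + c) Q)
      (Pos c k (a + ee k) b (Q + {nacci c k 3})) := by
  by_cases h : k = 1
  · subst h
    left
    refine ⟨2, by omega, ?_⟩
    rw [show Finset.Icc (2 - 1) 2 = insert 1 {2} from rfl, block_insert _ _ _ _ (by simp),
      block_single]
    apply sub_form (R := Pos c 1 (a + 1) b Q)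
    · unfold Pos
      rw [show a + (c + 1) = c + (a + 1) by ring, Multiset.replicate_add c,
        Multiset.replicate_add b]; abel
    · unfold Pos ee
      rw [if_pos rfl]
      abel
  · right; left
    refine ⟨2, by omega, by omega, ?_⟩
    rw [show Finset.Icc 2 2 = {2} from rfl, block_single]
    apply sub_form (R := Pos c k a b Q)
    · unfold Pos; rw [Multiset.replicate_add a, Multiset.replicate_add b]; abel
    · unfold Pos ee
      rw [if_neg h, add_zero]
      abel

/-- The move to `S_4` when `c = 1`. -/
lemma move_four (k a : ℕ) (hk : 1 ≤ k) :
    ∃ a', a ≤ a' ∧ CkMove 1 k (Pos 1 k (a + 2) 1 (Multiset.replicate 1 (nacci 1 k 3)))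
      (Pos 1 k a' 0 (Multiset.replicate 1 (nacci 1 k 4))) := by
  rcases (by omega : k = 1 ∨ k = 2 ∨ 3 ≤ k) with h | h | h
  · subst h
    refine ⟨a + 2, by omega, ?_⟩
    left
    refine ⟨3, by omega, ?_⟩
    rw [show Finset.Icc (3 - 1) 3 = insert 2 {3} from rfl, block_insert _ _ _ _ (by simp),
      block_single]
    apply sub_form (R := Pos 1 1 (a + 2) 0 0)
    · unfold Pos; simp only [Multiset.replicate_zero]; abel
    · unfold Pos; simp only [Multiset.replicate_zero, Multiset.replicate_one]; abel
  · subst h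
    refine ⟨a + 1, by omega, ?_⟩
    left
    refine ⟨3, by omega, ?_⟩
    rw [show Finset.Icc (3 - 2) 3 = insert 1 (insert 2 {3}) from rfl,
      block_insert _ _ _ _ (by simp), block_insert _ _ _ _ (by simp),
      block_single]
    apply sub_form (R := Pos 1 2 (a + 1) 0 0)
    · unfold Pos
      rw [show a + 2 = (a + 1) + 1 from rfl, Multiset.replicate_add (a + 1)]
      simp only [Multiset.replicate_zero]; abel
    · unfold Pos; simp only [Multiset.replicate_zero, Multiset.replicate_one]; abel
  · refine ⟨a, le_rfl, ?_⟩
    right; left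
    refine ⟨3, by omega, by omega, ?_⟩
    rw [show Finset.Icc 2 3 = insert 2 {3} from rfl, block_insert _ _ _ _ (by simp),
      block_single]
    apply sub_form (R := Pos 1 k a 0 0)
    · unfold Pos
      rw [Multiset.replicate_add a]
      simp only [Multiset.replicate_zero]; abel
    · unfold Pos; simp only [Multiset.replicate_zero, Multiset.replicate_one]; abel

lemma count_pos (c k a b d j i : ℕ) (hc : 1 ≤ c) (hk : 1 ≤ k) (hj : 3 ≤ j) (hi : 1 ≤ i) :
    (Pos c k a b (Multiset.replicate d (nacci c k j))).count (nacci c k i) =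
      (if i = 1 then a else 0) + (if i = 2 then b else 0) + (if i = j then d else 0) := by
  unfold Pos
  simp only [Multiset.count_add, Multiset.count_replicate]
  simp only [nacci_inj c k hc hk 1 i (by omega) hi, nacci_inj c k hc hk 2 i (by omega) hi,
    nacci_inj c k hc hk j i (by omega) hi, @eq_comm _ _ i]

/-- Classification of the moves from simple positions. -/
lemma forced (c k a b d j : ℕ) (hc : 1 ≤ c) (hk : 1 ≤ k) (hj : 3 ≤ j) (hb : b ≤ c)
    (hd : d ≤ c) (hbd : b < c ∨ d = 0) (B : Multiset ℕ)
    (h : CkMove c k (Pos c k a b (Multiset.replicate d (nacci c k j))) B) :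
    (∃ a', a = a' + (c + 1) ∧ B = Pos c k a' (b + 1) (Multiset.replicate d (nacci c k j))) ∨
    (b = c ∧ ∃ a', a + ee k = a' + (c + 1) ∧
      B = Pos c k a' 0 (Multiset.replicate 1 (nacci c k 3))) := by
  have hcnt : ∀ i r, 1 ≤ i → Multiset.replicate r (nacci c k i) ≤
      Pos c k a b (Multiset.replicate d (nacci c k j)) →
      r ≤ (if i = 1 then a else 0) + (if i = 2 then b else 0) + (if i = j then d else 0) := by
    intro i r hi hle
    rw [← count_pos c k a b d j i hc hk hj hi]
    exact Multiset.le_count_iff_replicate_le.2 hle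
  have hbig : ∀ i, 2 ≤ i → ¬ Multiset.replicate (c + 1) (nacci c k i) ≤
      Pos c k a b (Multiset.replicate d (nacci c k j)) := by
    intro i hi hle
    have := hcnt i _ (by omega) hle
    split_ifs at this <;> omega
  rcases h with ⟨i, hi, hle, hB⟩ | ⟨i, hi, hik, hle, hB⟩ | ⟨hle, hB⟩ | ⟨i, hi, hik, hle, hB⟩ |
    ⟨hle, hB⟩ | ⟨i, hi, hle, hB⟩
  · have hmem : ∀ l, i - k ≤ l → l ≤ i →
        c ≤ (if l = 1 then a else 0) + (if l = 2 then b else 0) + (if l = j then d else 0) := by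
      intro l h1 h2
      exact hcnt l c (by omega) ((block_le c k _ l (Finset.mem_Icc.2 ⟨h1, h2⟩)).trans hle)
    have h1 := hmem i (by omega) le_rfl
    have h2 := hmem (i - 1) (by omega) (by omega)
    have hi2 : i ≤ 2 := by
      by_contra hcon
      rw [if_neg (by omega), if_neg (by omega)] at h1
      rw [if_neg (by omega : ¬ i - 1 = 1)] at h2
      split_ifs at h1 h2 <;> omega
    have hi2' : i = 2 := by omega
    have hk1 : k = 1 := by omega
    subst hi2' hk1
    right
    simp only [if_neg (by omega : ¬ 2 = j), if_neg (by omega : ¬ 1 = j), if_pos,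
      if_neg (by omega : ¬ 2 = 1), if_neg (by omega : ¬ 2 - 1 = 2),
      if_neg (by omega : ¬ 2 - 1 = j), if_pos (by omega : 2 - 1 = 1)] at h1 h2
    have hbc : b = c := by omega
    have hd0 : d = 0 := by omega
    subst hd0 hbc
    obtain ⟨a', rfl⟩ : ∃ a', a = a' + b := ⟨a - b, by omega⟩
    refine ⟨rfl, a', by unfold ee; rw [if_pos rfl]; omega, ?_⟩
    rw [show Finset.Icc (2 - 1) 2 = insert 1 {2} from rfl, block_insert _ _ _ _ (by simp),
      block_single] at hB
    rw [sub_form' (R := Pos b 1 a' 0 0) _ hB]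
    · unfold Pos; simp only [Multiset.replicate_zero, Multiset.replicate_one]; abel
    · unfold Pos; simp only [Multiset.replicate_zero, Multiset.replicate_add]; abel
  · have hmem : ∀ l, 2 ≤ l → l ≤ i →
        c ≤ (if l = 1 then a else 0) + (if l = 2 then b else 0) + (if l = j then d else 0) := by
      intro l h1 h2
      exact hcnt l c (by omega) (((block_le c k _ l (Finset.mem_Icc.2 ⟨h1, h2⟩)).trans
        (Multiset.le_add_left _ _)).trans hle)
    have h2 := hmem 2 le_rfl hi
    have h0 := hcnt 1 (c + 1) le_rfl ((Multiset.le_add_right _ _).trans hle)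
    simp only [if_neg (by omega : ¬ 2 = j), if_neg (by omega : ¬ 1 = j), if_pos,
      if_neg (by omega : ¬ 2 = 1), if_neg (by omega : ¬ 1 = 2)] at h0 h2
    have hbc : b = c := by omega
    have hd0 : d = 0 := by omega
    have hi2 : i = 2 := by
      by_contra hcon
      have h1 := hmem i (by omega) le_rfl
      rw [if_neg (by omega), if_neg (by omega)] at h1
      split_ifs at h1 <;> omega
    subst hi2 hd0 hbc
    right
    obtain ⟨a', rfl⟩ : ∃ a', a = a' + (b + 1) := ⟨a - (b + 1), by omega⟩
    refine ⟨rfl, a', by unfold ee; rw [if_neg (by omega)]; omega, ?_⟩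
    rw [show Finset.Icc 2 2 = {2} from rfl, block_single] at hB
    rw [sub_form' (R := Pos b k a' 0 0) _ hB]
    · unfold Pos; simp only [Multiset.replicate_zero, Multiset.replicate_one]; abel
    · unfold Pos; rw [Multiset.replicate_add a']; simp only [Multiset.replicate_zero]; abel
  · left
    have h0 := hcnt 1 (c + 1) le_rfl hle
    simp only [if_neg (by omega : ¬ 1 = j), if_pos, if_neg (by omega : ¬ 1 = 2)] at h0
    obtain ⟨a', rfl⟩ : ∃ a', a = a' + (c + 1) := ⟨a - (c + 1), by omega⟩
    refine ⟨a', rfl, ?_⟩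
    rw [sub_form' (R := Pos c k a' b (Multiset.replicate d (nacci c k j))) _ hB]
    · unfold Pos; rw [Multiset.replicate_add b, Multiset.replicate_one]; abel
    · unfold Pos; rw [Multiset.replicate_add a']; abel
  · exact absurd hle (hbig i (by omega))
  · exact absurd hle (hbig (k + 1) (by omega))
  · exact absurd hle (hbig i (by omega))

section game

variable {Move : Multiset ℕ → Multiset ℕ → Prop} {p m : ℕ}

lemma wins_opp {t : ℕ} {A B : Multiset ℕ}
    (h : AllianceWins Move p (fun q => q = m) t A) (ht : t % p + 1 ≠ m) (hm : Move A B) :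
    AllianceWins Move p (fun q => q = m) (t + 1) B := by
  cases h with
  | endMove _ _ _ hturn => exact absurd hturn ht
  | contMove _ _ _ hturn => exact absurd hturn ht
  | oppMove _ _ _ _ hall => exact hall B hm

lemma wins_any {t : ℕ} {A : Multiset ℕ}
    (h : AllianceWins Move p (fun q => q = m) t A) :
    ∃ B, Move A B ∧ (AllianceWins Move p (fun q => q = m) (t + 1) B ∨ Terminal Move B) := by
  cases h with
  | endMove _ _ B hturn hmove hterm => exact ⟨B, hmove, Or.inr hterm⟩
  | contMove _ _ B hturn hmove hwin => exact ⟨B, hmove, Or.inl hwin⟩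
  | oppMove _ _ _ hex hall =>
    obtain ⟨B, hB⟩ := hex
    exact ⟨B, hB, Or.inl (hall B hB)⟩

lemma wins_not_terminal {t : ℕ} {A : Multiset ℕ}
    (h : AllianceWins Move p (fun q => q = m) t A) : ¬ Terminal Move A := by
  intro hA
  obtain ⟨B, hB, _⟩ := wins_any h
  exact hA B hB

lemma mod_succ_ne (hp : 2 ≤ p) (t : ℕ) : t % p ≠ (t + 1) % p := by
  intro h
  have h1 : t + 0 ≡ t + 1 [MOD p] := h
  have h2 := Nat.ModEq.add_left_cancel' t h1
  have h3 : 0 % p = 1 % p := h2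
  rw [Nat.zero_mod, Nat.mod_eq_of_lt (by omega)] at h3
  omega

lemma wins_shift (hp : 2 ≤ p) {t : ℕ} {A : Multiset ℕ}
    (h : AllianceWins Move p (fun q => q = m) t A) :
    ¬ AllianceWins Move p (fun q => q = m) (t + 1) A := by
  induction h with
  | endMove t A B hturn hmove hterm =>
    intro h2
    have := mod_succ_ne hp t
    exact wins_not_terminal (wins_opp h2 (by omega) hmove) hterm
  | contMove t A B hturn hmove hwin ih =>
    intro h2
    have := mod_succ_ne hp t
    exact ih (wins_opp h2 (by omega) hmove)
  | oppMove t A hturn hex hall ih =>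
    intro h2
    obtain ⟨B, hB, h3 | h3⟩ := wins_any h2
    · exact ih B hB h3
    · exact wins_not_terminal (hall B hB) h3

lemma turn_ne (hmp : m ≤ p) (hm : 1 ≤ m) (q t : ℕ) (h1 : p * q + m ≤ t)
    (h2 : t + 1 < p * (q + 1) + m) : t % p + 1 ≠ m := by
  intro h
  have h3 := Nat.div_add_mod t p
  have h4 : p * q < p * (t / p) + 1 + 0 := by omega
  have h5 : p * (t / p) < p * (q + 1) := by omega
  have h6 : p * q < p * (t / p) := by omega
  have h7 := lt_of_mul_lt_mul_left h5 (Nat.zero_le p)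
  have h8 := lt_of_mul_lt_mul_left h6 (Nat.zero_le p)
  omega

lemma turn_ne0 (t : ℕ) (h2 : t + 1 < m) : t % p + 1 ≠ m := by
  have := Nat.mod_le t p
  omega

end game

/-- Winning for player `m`. -/
abbrev W (c k p m t : ℕ) (A : Multiset ℕ) : Prop :=
  AllianceWins (CkMove c k) p (fun q => q = m) t A

/-- Opponents merge `r` times. -/
lemma run {c k p m : ℕ} (r : ℕ) : ∀ {t a b : ℕ} {Q : Multiset ℕ},
    W c k p m t (Pos c k (a + r * (c + 1)) b Q) →
    (∀ i, i < r → (t + i) % p + 1 ≠ m) → W c k p m (t + r) (Pos c k a (b + r) Q) := by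
  induction r with
  | zero => intro t a b Q h _; simpa using h
  | succ r ih =>
    intro t a b Q h ht
    have h0 := ht 0 (by omega)
    rw [show a + (r + 1) * (c + 1) = (a + r * (c + 1)) + (c + 1) by ring] at h
    have h1 := wins_opp h (by simpa using h0) (move_merge c k _ b Q)
    have h2 := ih h1 (fun i hi => by
      have := ht (i + 1) (by omega)
      rwa [show t + 1 + i = t + (i + 1) by ring])
    rwa [show t + (r + 1) = t + 1 + r by ring, show b + (r + 1) = b + 1 + r by ring]

lemma split {c k p m : ℕ} (hk : 1 ≤ k) (hp : 2 ≤ p) {t a b : ℕ} {Q : Multiset ℕ}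
    (h : W c k p m t (Pos c k (a + (c + 1)) (b + c) Q))
    (h0 : t % p + 1 ≠ m) (h1 : (t + 1) % p + 1 ≠ m) : False := by
  have hA := wins_opp h h0 (move_comb c k a b Q hk)
  have hB := wins_opp (wins_opp h h0 (move_merge c k a (b + c) Q)) h1
    (move_merge2 c k a b Q hk)
  exact wins_shift hp hA hB

lemma finish {c k p m : ℕ} (hk : 1 ≤ k) (hp : 2 ≤ p) {t a b : ℕ} {Q : Multiset ℕ} (r : ℕ)
    (hr : b + r = c) (h : W c k p m t (Pos c k a b Q)) (ha : (r + 1) * (c + 1) ≤ a)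
    (ht : ∀ i, i < r + 2 → (t + i) % p + 1 ≠ m) : False := by
  obtain ⟨a', rfl⟩ : ∃ a', a = (a' + (c + 1)) + r * (c + 1) :=
    ⟨a - (r + 1) * (c + 1), by rw [add_mul] at *; omega⟩
  have h1 := run r h (fun i hi => ht i (by omega))
  rw [hr] at h1
  refine split (c := c) (b := 0) hk hp (t := t + r) (a := a') (Q := Q) ?_ (ht r (by omega))
    (ht (r + 1) (by omega))
  rwa [zero_add]

lemma not_term {c k a b : ℕ} {Q : Multiset ℕ} (h : c + 1 ≤ a) :
    ¬ Terminal (CkMove c k) (Pos c k a b Q) := by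
  intro ht
  obtain ⟨a', rfl⟩ : ∃ a', a = a' + (c + 1) := ⟨a - (c + 1), by omega⟩
  exact ht _ (move_merge c k a' b Q)

/-- Any player has to merge. -/
lemma forced_turn {c k p m : ℕ} (hc : 1 ≤ c) (hk : 1 ≤ k) {t a b d j : ℕ} (hj : 3 ≤ j)
    (hb : b < c) (hd : d ≤ c) (ha : c + 1 ≤ a)
    (h : W c k p m t (Pos c k (a + (c + 1)) b (Multiset.replicate d (nacci c k j)))) :
    W c k p m (t + 1) (Pos c k a (b + 1) (Multiset.replicate d (nacci c k j))) := by
  obtain ⟨B, hB, h1⟩ := wins_any h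
  rcases forced c k _ b d j hc hk hj hb.le hd (Or.inl hb) B hB with ⟨a', ha', rfl⟩ | ⟨h2, _⟩
  · have : a' = a := by omega
    subst this
    rcases h1 with h1 | h1
    · exact h1
    · exact absurd h1 (not_term ha)
  · omega

/-- Initially everybody has to merge. -/
lemma forced_run {c k p m : ℕ} (hc : 1 ≤ c) (hk : 1 ≤ k) (r : ℕ) : ∀ {a : ℕ}, r ≤ c →
    c + 1 ≤ a →
    W c k p m 0 (Pos c k (a + r * (c + 1)) 0 (Multiset.replicate 0 (nacci c k 3))) →
    W c k p m r (Pos c k a r (Multiset.replicate 0 (nacci c k 3))) := by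
  induction r with
  | zero => intro a _ _ h; simpa using h
  | succ r ih =>
    intro a hr ha h
    apply forced_turn hc hk (by omega) (by omega) (by omega) ha
    apply ih (by omega) (by omega)
    rwa [show a + (c + 1) + r * (c + 1) = a + (r + 1) * (c + 1) by ring]

/-- For every `c ≥ 1`, `k ≥ 1`, every `n ≥ 3c² + 6c + 3`, and every number of players
`p ≥ c + 2`, no player has a winning strategy in the `p`-player `(c,k)`-nacci
Zeckendorf game on `n`. -/
theorem multiplayer_ck_nacci_no_winner (c k n p : ℕ)
    (hc : 1 ≤ c) (hk : 1 ≤ k) (hn : 3 * c ^ 2 + 6 * c + 3 ≤ n) (hp : c + 2 ≤ p) :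
    ∀ m, 1 ≤ m → m ≤ p → ¬ PlayerWins (CkMove c k) p m n := by
  intro m hm hmp hwin
  have hp2 : 2 ≤ p := by omega
  have h0 : W c k p m 0 (Pos c k n 0 (Multiset.replicate 0 (nacci c k 3))) := by
    have : Pos c k n 0 (Multiset.replicate 0 (nacci c k 3)) = Multiset.replicate n 1 := by
      unfold Pos; rw [nacci_one']; simp
    unfold W; rw [this]; exact hwin
  clear hwin
  obtain ⟨s, rfl⟩ : ∃ s, n = s + 3 * ((c + 1) * (c + 1)) :=
    ⟨n - 3 * ((c + 1) * (c + 1)), by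
      have : 3 * ((c + 1) * (c + 1)) = 3 * c ^ 2 + 6 * c + 3 := by ring
      omega⟩
  clear hn
  have hsing : ∀ x : ℕ, Multiset.replicate 0 x + {x} = Multiset.replicate 1 x := by
    intro x; simp
  have hNN : c + 1 ≤ (c + 1) * (c + 1) := by nlinarith
  have hexp : (c + 1) * (c + 1) = c * (c + 1) + (c + 1) := by ring
  rcases (by omega : m ≤ c ∨ m = c + 1 ∨ m = c + 2 ∨ c + 3 ≤ m) with h | h | h | h
  · -- early players
    obtain ⟨r, hr⟩ : ∃ r, m + r = c := ⟨c - m, by omega⟩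
    have hmr : m * (c + 1) + r * (c + 1) = c * (c + 1) := by rw [← add_mul, hr]
    have h1 := forced_run (a := s + 3 * ((c + 1) * (c + 1)) - m * (c + 1)) hc hk m h
      (by omega) (by
        rwa [Nat.sub_add_cancel (by omega)])
    refine finish hk hp2 r hr h1 (by rw [add_mul]; omega) ?_
    intro i hi
    exact turn_ne hmp hm 0 _ (by omega) (by omega)
  · -- player `c + 1`
    have h1 := forced_run (a := s + 2 * ((c + 1) * (c + 1)) + (c + 1)) hc hk c le_rfl
      (by omega) (by
        rwa [show s + 2 * ((c + 1) * (c + 1)) + (c + 1) + c * (c + 1) =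
          s + 3 * ((c + 1) * (c + 1)) by ring])
    obtain ⟨B, hB, h2⟩ := wins_any h1
    rcases forced c k _ c 0 3 hc hk le_rfl le_rfl (by omega) (Or.inr rfl) B hB with
      ⟨a', ha', rfl⟩ | ⟨_, a', ha', rfl⟩
    · have h3 := h2.resolve_right (not_term (by omega))
      obtain ⟨a2, rfl⟩ : ∃ a2, a' = a2 + (c + 1) := ⟨a' - (c + 1), by omega⟩
      rw [add_comm c 1] at h3
      exact split hk hp2 (by rwa [add_comm 1 c] at h3 ⊢)
        (turn_ne hmp hm 0 _ (by omega) (by omega))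
        (turn_ne hmp hm 0 _ (by omega) (by omega))
    · have h3 := h2.resolve_right (not_term (by omega))
      rcases Nat.lt_or_ge (c + 2) p with hp3 | hp3
      · refine finish hk hp2 c (by omega) h3 (by omega) ?_
        intro i hi
        exact turn_ne hmp hm 0 _ (by omega) (by omega)
      · have hpc : p = c + 2 := by omega
        rcases (by omega : c = 1 ∨ 2 ≤ c) with hc1 | hc2
        · subst hc1
          obtain ⟨a2, rfl⟩ : ∃ a2, a' = ((a2 + 4) + 2) + (1 + 1) := ⟨a' - 8, by omega⟩
          have h4 := wins_opp h3 (turn_ne hmp hm 0 _ (by omega) (by omega))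
            (move_merge 1 k _ 0 _)
          obtain ⟨a3, ha3, h5⟩ := move_four k (a2 + 4) hk
          have h6 := wins_opp h4 (turn_ne hmp hm 0 _ (by omega) (by omega)) h5
          obtain ⟨a4, rfl⟩ : ∃ a4, a3 = (a4 + 2) + (1 + 1) := ⟨a3 - 4, by omega⟩
          have h7 := forced_turn hc hk (by omega) (by omega) (by omega) (by omega) h6
          refine finish hk hp2 0 (by omega) h7 (by omega) ?_
          intro i hi
          exact turn_ne hmp hm 1 _ (by omega) (by omega)
        · obtain ⟨a2, rfl⟩ : ∃ a2, a' = (a2 + (c + 1)) + c * (c + 1) :=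
            ⟨a' - (c + 1) * (c + 1), by omega⟩
          have h4 := run c h3 (fun i hi => turn_ne hmp hm 0 _ (by omega) (by omega))
          have h5 := wins_opp h4 (turn_ne hmp hm 0 _ (by omega) (by omega))
            (move_comb c k a2 0 _ hk)
          rw [← Multiset.replicate_one, ← Multiset.replicate_add] at h5
          obtain ⟨a3, ha3⟩ : ∃ a3, a2 + ee k = a3 + (c + 1) :=
            ⟨a2 + ee k - (c + 1), by omega⟩
          rw [ha3] at h5
          have hc2' : c + 1 ≤ c * (c + 1) := by nlinarith
          have h6 := forced_turn hc hk (by omega) (by omega) (by omega) (by omega) h5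
          refine finish hk hp2 (c - 1) (by omega) h6 ?_ ?_
          · rw [Nat.sub_add_cancel hc]; omega
          · intro i hi
            exact turn_ne hmp hm 1 _ (by omega) (by omega)
  · -- player `c + 2`
    have h1 := forced_run (a := s + 2 * ((c + 1) * (c + 1)) + (c + 1)) hc hk c le_rfl
      (by omega) (by
        rwa [show s + 2 * ((c + 1) * (c + 1)) + (c + 1) + c * (c + 1) =
          s + 3 * ((c + 1) * (c + 1)) by ring])
    have hmv := move_comb c k (s + 2 * ((c + 1) * (c + 1))) 0
      (Multiset.replicate 0 (nacci c k 3)) hk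
    rw [zero_add] at hmv
    have h2 := wins_opp h1 (turn_ne0 _ (by omega)) hmv
    rw [hsing] at h2
    obtain ⟨a3, ha3⟩ : ∃ a3, s + 2 * ((c + 1) * (c + 1)) + ee k = a3 + (c + 1) :=
      ⟨s + 2 * ((c + 1) * (c + 1)) + ee k - (c + 1), by omega⟩
    rw [ha3] at h2
    have h6 := forced_turn hc hk (by omega) (by omega) (by omega) (by omega) h2
    refine finish hk hp2 (c - 1) (by omega) h6 ?_ ?_
    · rw [Nat.sub_add_cancel hc]; omega
    · intro i hi
      exact turn_ne hmp hm 0 _ (by omega) (by omega)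
  · -- late players
    refine finish hk hp2 c (by omega) h0 (by omega) ?_
    intro i hi
    exact turn_ne0 _ (by omega)
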